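/- Let f be a profile function, k ≥ 1 an integer, and let λ be the least eigenvalue of L_k (IsLeast (Spec L_k) λ). Let u : ℝ → ℝ be continuous on [-1,1], smooth on (-1,1), with u(-1) = u(1) = 0 and u not identically zero on (-1,1), and assume x ↦ f(x)·u'(x)² + (k²/f(x))·u(x)² is interval integrable on [-1,1]. Then λ ≤ (∫_{-1}^{1} [f(x)·u'(x)² + (k²/f(x))·u(x)²] dx) / (∫_{-1}^{1} u(x)² dx). -/

import Mathlib

open Set MeasureTheory intervalIntegral Filter

/-- A profile function for a surface of revolution diffeomorphic to `S²` of area `4π`: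
continuous on `[-1,1]`, smooth and positive on `(-1,1)`, vanishing at `±1`,
with derivative `2` at `-1` and `-2` at `1`. -/
structure IsProfile (f : ℝ → ℝ) : Prop where
  contOn : ContinuousOn f (Icc (-1) 1)
  smoothOn : ContDiffOn ℝ (⊤ : ℕ∞) f (Ioo (-1) 1)
  pos : ∀ x ∈ Ioo (-1:ℝ) 1, 0 < f x
  zero_neg_one : f (-1) = 0
  zero_one : f 1 = 0
  deriv_neg_one : HasDerivAt f 2 (-1)
  deriv_one : HasDerivAt f (-2) 1

/-- `λ` is an eigenvalue of the Sturm–Liouville operator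
`L_k = -(d/dx)(f(x) d/dx) + k²/f(x)` on `(-1,1)`, with Dirichlet boundary
conditions at `±1` when `k ≥ 1`. -/
def InSpec (f : ℝ → ℝ) (k : ℕ) (lam : ℝ) : Prop :=
  ∃ u : ℝ → ℝ, ContinuousOn u (Icc (-1) 1) ∧ ContDiffOn ℝ (⊤ : ℕ∞) u (Ioo (-1) 1) ∧
    (∃ x ∈ Ioo (-1:ℝ) 1, u x ≠ 0) ∧
    (1 ≤ k → u (-1) = 0 ∧ u 1 = 0) ∧
    ∀ x ∈ Ioo (-1:ℝ) 1,
      -(deriv (fun y => f y * deriv u y) x) + ((k:ℝ)^2 / f x) * u x = lam * u x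

/-- The spectrum of `L_k`. -/
def Spec (f : ℝ → ℝ) (k : ℕ) : Set ℝ := {lam | InSpec f k lam}

/-- The set of distinct eigenvalues of the Laplacian of the surface of
revolution determined by `f`. -/
def Eigs (f : ℝ → ℝ) : Set ℝ := ⋃ k : ℕ, Spec f k

open scoped Topology InnerProductSpace

theorem exists_subseq_weak_limit {H : Type*} [NormedAddCommGroup H] [InnerProductSpace ℝ H]
    [CompleteSpace H] [TopologicalSpace.SeparableSpace H] (v : ℕ → H) (hv : ∀ n, ‖v n‖ ≤ 1) :
    ∃ w : H, ‖w‖ ≤ 1 ∧ ∃ φ : ℕ → ℕ, StrictMono φ ∧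
      ∀ h, Tendsto (fun n => ⟪v (φ n), h⟫_ℝ) atTop (𝓝 ⟪w, h⟫_ℝ) := by
  obtain ⟨ℓ, hℓ, φ, hφ, hlim⟩ := WeakDual.isSeqCompact_closedBall ℝ H 0 1
    (x := fun n => StrongDual.toWeakDual (InnerProductSpace.toDual ℝ H (v n)))
    (fun n => by simpa using hv n)
  refine ⟨(InnerProductSpace.toDual ℝ H).symm (WeakDual.toStrongDual ℓ), by simpa using hℓ,
    φ, hφ, fun h => ?_⟩
  have := ((WeakDual.eval_continuous (𝕜 := ℝ) h).tendsto ℓ).comp hlim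
  simpa [Function.comp_def] using this

theorem exists_eigenvector_of_weak_continuous {H : Type*} [NormedAddCommGroup H]
    [InnerProductSpace ℝ H] [CompleteSpace H] [TopologicalSpace.SeparableSpace H]
    (T : H →L[ℝ] H) (hT : IsSelfAdjoint T)
    (hcomp : ∀ (v : ℕ → H) (w : H), (∀ n, ‖v n‖ ≤ 1) →
      (∀ h, Tendsto (fun n => ⟪v n, h⟫_ℝ) atTop (𝓝 ⟪w, h⟫_ℝ)) →
      Tendsto (fun n => T (v n)) atTop (𝓝 (T w)))
    (v₀ : H) (hv₀ : 0 < ⟪T v₀, v₀⟫_ℝ) :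
    ∃ M > 0, (∃ w ≠ 0, T w = M • w) ∧ ∀ v, ⟪T v, v⟫_ℝ ≤ M * ‖v‖ ^ 2 := by
  set S : Set ℝ := image (fun v => ⟪T v, v⟫_ℝ) (Metric.closedBall 0 1) with hS
  have hne : S.Nonempty := ⟨_, 0, by simp, rfl⟩
  have hbdd : BddAbove S := by
    refine ⟨‖T‖, ?_⟩
    rintro _ ⟨v, hv, rfl⟩
    have hv : ‖v‖ ≤ 1 := by simpa using hv
    calc ⟪T v, v⟫_ℝ ≤ ‖T v‖ * ‖v‖ := real_inner_le_norm _ _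
      _ ≤ (‖T‖ * 1) * 1 := by gcongr; exact T.le_opNorm_of_le hv
      _ = ‖T‖ := by ring
  have hscale : ∀ v, ⟪T v, v⟫_ℝ ≤ sSup S * ‖v‖ ^ 2 := by
    intro v
    rcases eq_or_ne v 0 with rfl | hv
    · simp
    have hv' : 0 < ‖v‖ := norm_pos_iff.mpr hv
    have : ⟪T (‖v‖⁻¹ • v), ‖v‖⁻¹ • v⟫_ℝ ≤ sSup S :=
      le_csSup hbdd ⟨_, by simp [norm_smul, hv'.ne'], rfl⟩
    rw [map_smul, real_inner_smul_left, real_inner_smul_right] at this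
    field_simp at this
    linarith
  have hM : 0 < sSup S := by
    by_contra! h
    nlinarith [hscale v₀, sq_nonneg ‖v₀‖]
  obtain ⟨a, -, ha, haS⟩ := exists_seq_tendsto_sSup hne hbdd
  choose v hv hva using haS
  have hv1 : ∀ n, ‖v n‖ ≤ 1 := fun n => by simpa using hv n
  obtain ⟨w, hw, φ, hφ, hlim⟩ := exists_subseq_weak_limit v hv1
  have hTw := hcomp (v ∘ φ) w (fun n => hv1 _) hlim
  have hsup : ⟪T w, w⟫_ℝ = sSup S := by
    refine tendsto_nhds_unique ?_ (ha.comp hφ.tendsto_atTop)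
    have h1 : Tendsto (fun n => ⟪T (v (φ n)) - T w, v (φ n)⟫_ℝ) atTop (𝓝 0) := by
      refine squeeze_zero_norm (fun n => ?_) (tendsto_iff_norm_sub_tendsto_zero.mp hTw)
      calc _ ≤ ‖T (v (φ n)) - T w‖ * ‖v (φ n)‖ := norm_inner_le_norm _ _
        _ ≤ ‖T (v (φ n)) - T w‖ * 1 := by gcongr; exact hv1 _
        _ = _ := by simp
    have h2 := h1.add (hlim (T w))
    rw [zero_add, real_inner_comm] at h2
    refine h2.congr fun n => ?_
    rw [real_inner_comm (T w), ← inner_add_left, sub_add_cancel]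
    exact hva _
  have hw1 : ‖w‖ = 1 := by
    have := hscale w
    rw [hsup] at this
    have h1 : 1 ≤ ‖w‖ ^ 2 := by
      by_contra! h
      nlinarith
    nlinarith [norm_nonneg w]
  have hmax : IsMaxOn T.reApplyInnerSelf (Metric.sphere 0 ‖w‖) w := by
    intro v hv
    have hv : ‖v‖ = 1 := by simpa [hw1] using hv
    have := hscale v
    simp only [mem_ofPred_eq, ContinuousLinearMap.reApplyInnerSelf_apply, RCLike.re_to_real]
    rw [hsup]
    simpa [hv] using this
  refine ⟨sSup S, hM, ⟨w, by rintro rfl; simp at hw1, ?_⟩, hscale⟩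
  have := hT.eq_smul_self_of_isLocalExtrOn_real (Or.inr hmax.localize)
  rw [this, ContinuousLinearMap.rayleighQuotient, ContinuousLinearMap.reApplyInnerSelf_apply]
  simp [hsup, hw1]

section Kernel

variable {X : Type*} [MeasurableSpace X] {μ : Measure X} {G : X → X → ℝ} {C : ℝ}

theorem integrable_kernel_mul (hG : Measurable (Function.uncurry G)) (hC : ∀ x y, |G x y| ≤ C)
    {v : X → ℝ} (hv : Integrable v μ) (x : X) : Integrable (fun y => G x y * v y) μ :=
  hv.bdd_mul (hG.comp measurable_prodMk_left).aestronglyMeasurable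
    (Eventually.of_forall fun y => hC x y)

theorem abs_integral_kernel_le (hC : ∀ x y, |G x y| ≤ C) {v : X → ℝ} (hv : Integrable v μ)
    (x : X) : |∫ y, G x y * v y ∂μ| ≤ C * ∫ y, |v y| ∂μ := by
  rw [← MeasureTheory.integral_const_mul]
  rw [← Real.norm_eq_abs]
  refine norm_integral_le_of_norm_le (hv.abs.const_mul C) (Eventually.of_forall fun y => ?_)
  rw [Real.norm_eq_abs, abs_mul]
  exact mul_le_mul_of_nonneg_right (hC x y) (abs_nonneg _)

variable [IsFiniteMeasure μ]

theorem memLp_integral_kernel (hG : Measurable (Function.uncurry G)) (hC : ∀ x y, |G x y| ≤ C)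
    {v : X → ℝ} (hv : Integrable v μ) : MemLp (fun x => ∫ y, G x y * v y ∂μ) 2 μ := by
  refine MemLp.of_bound ?_ (C * ∫ y, |v y| ∂μ)
    (Eventually.of_forall fun x => abs_integral_kernel_le hC hv x)
  have : AEStronglyMeasurable (fun z : X × X => G z.1 z.2 * v z.2) (μ.prod μ) :=
    hG.aestronglyMeasurable.mul hv.aestronglyMeasurable.comp_snd
  exact this.integral_prod_right'

theorem integral_abs_le_norm (v : Lp ℝ 2 μ) :
    ∫ y, |v y| ∂μ ≤ (∫ _, (1 : ℝ) ∂μ) ^ (1 / 2 : ℝ) * ‖v‖ := by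
  have h1 : MemLp (fun _ : X => (1 : ℝ)) (ENNReal.ofReal 2) μ := memLp_const _
  have h2 : MemLp v (ENNReal.ofReal 2) μ := by simpa using Lp.memLp v
  have := integral_mul_norm_le_Lp_mul_Lq (f := fun _ : X => (1 : ℝ)) (g := v)
    (by constructor <;> norm_num : Real.HolderConjugate 2 2) h1 h2
  have hn : ‖v‖ = (∫ a, ‖v a‖ ^ (2 : ℝ) ∂μ) ^ (1 / 2 : ℝ) := by
    rw [Lp.norm_def, (Lp.memLp v).eLpNorm_eq_integral_rpow_norm (by norm_num) (by norm_num),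
      ENNReal.toReal_ofReal (by positivity)]
    norm_num
  rw [hn]
  simpa using this

theorem exists_kernel_operator (hG : Measurable (Function.uncurry G))
    (hC : ∀ x y, |G x y| ≤ C) :
    ∃ T : Lp ℝ 2 μ →L[ℝ] Lp ℝ 2 μ, ∀ v, T v =ᵐ[μ] fun x => ∫ y, G x y * v y ∂μ := by
  have hint : ∀ v : Lp ℝ 2 μ, Integrable v μ := fun v => (Lp.memLp v).integrable (by norm_num)
  have hmem := fun v => memLp_integral_kernel hG hC (hint v)
  let T : Lp ℝ 2 μ →ₗ[ℝ] Lp ℝ 2 μ :=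
    { toFun := fun v => (hmem v).toLp _
      map_add' := fun v w => by
        rw [← MemLp.toLp_add, MemLp.toLp_eq_toLp_iff]
        refine Eventually.of_forall fun x => ?_
        simp only [Pi.add_apply]
        rw [← integral_add (integrable_kernel_mul hG hC (hint v) x)
          (integrable_kernel_mul hG hC (hint w) x)]
        refine integral_congr_ae ?_
        filter_upwards [Lp.coeFn_add v w] with y hy
        rw [hy, Pi.add_apply, mul_add]
      map_smul' := fun c v => by
        rw [RingHom.id_apply, ← MemLp.toLp_const_smul, MemLp.toLp_eq_toLp_iff]
        refine Eventually.of_forall fun x => ?_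
        simp only [Pi.smul_apply, smul_eq_mul]
        rw [← MeasureTheory.integral_const_mul]
        refine integral_congr_ae ?_
        filter_upwards [Lp.coeFn_smul c v] with y hy
        rw [hy, Pi.smul_apply, smul_eq_mul]
        ring }
  refine ⟨T.mkContinuous (μ.real univ ^ (2 : ENNReal).toReal⁻¹ *
    (|C| * (∫ _, (1 : ℝ) ∂μ) ^ (1 / 2 : ℝ))) fun v => ?_, fun v => (hmem v).coeFn_toLp⟩
  rw [mul_assoc]
  refine Lp.norm_le_of_ae_bound (by positivity) ?_
  filter_upwards [(hmem v).coeFn_toLp] with x hx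
  change ‖(hmem v).toLp _ x‖ ≤ _
  rw [hx, Real.norm_eq_abs, mul_assoc]
  calc _ ≤ C * ∫ y, |v y| ∂μ := abs_integral_kernel_le hC (hint v) x
    _ ≤ |C| * ∫ y, |v y| ∂μ := by gcongr; exact le_abs_self C
    _ ≤ _ := by gcongr; exact integral_abs_le_norm v

theorem isSelfAdjoint_kernel_operator (hG : Measurable (Function.uncurry G))
    (hC : ∀ x y, |G x y| ≤ C) (hsymm : ∀ x y, G x y = G y x) {T : Lp ℝ 2 μ →L[ℝ] Lp ℝ 2 μ}
    (hT : ∀ v, T v =ᵐ[μ] fun x => ∫ y, G x y * v y ∂μ) : IsSelfAdjoint T := by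
  have hint : ∀ v : Lp ℝ 2 μ, Integrable v μ := fun v => (Lp.memLp v).integrable (by norm_num)
  have key : ∀ v w : Lp ℝ 2 μ,
      ⟪T v, w⟫_ℝ = ∫ x, ∫ y, w x * (G x y * v y) ∂μ ∂μ := fun v w => by
    rw [L2.inner_def]
    refine integral_congr_ae ?_
    filter_upwards [hT v] with x hx
    rw [hx, MeasureTheory.integral_const_mul]
    simp
  rw [ContinuousLinearMap.isSelfAdjoint_iff_isSymmetric]
  intro v w
  change ⟪T v, w⟫_ℝ = ⟪v, T w⟫_ℝ
  rw [real_inner_comm (T w) v, key, key, integral_integral_swap]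
  · refine integral_congr_ae (Eventually.of_forall fun x => integral_congr_ae
      (Eventually.of_forall fun y => ?_))
    simp only [hsymm y x]
    ring
  · have h := ((hint w).mul_prod (hint v)).bdd_mul (c := C) hG.aestronglyMeasurable
      (Eventually.of_forall fun z => hC z.1 z.2)
    refine h.congr (Eventually.of_forall fun z => ?_)
    simp only [Function.uncurry]
    ring

theorem kernel_operator_tendsto (hG : Measurable (Function.uncurry G))
    (hC : ∀ x y, |G x y| ≤ C) {T : Lp ℝ 2 μ →L[ℝ] Lp ℝ 2 μ}
    (hT : ∀ v, T v =ᵐ[μ] fun x => ∫ y, G x y * v y ∂μ)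
    (v : ℕ → Lp ℝ 2 μ) (w : Lp ℝ 2 μ) (hv : ∀ n, ‖v n‖ ≤ 1)
    (hlim : ∀ h, Tendsto (fun n => ⟪v n, h⟫_ℝ) atTop (𝓝 ⟪w, h⟫_ℝ)) :
    Tendsto (fun n => T (v n)) atTop (𝓝 (T w)) := by
  have hint : ∀ v : Lp ℝ 2 μ, Integrable v μ := fun v => (Lp.memLp v).integrable (by norm_num)
  have hGx : ∀ x, MemLp (G x) 2 μ := fun x =>
    MemLp.of_bound (hG.comp measurable_prodMk_left).aestronglyMeasurable C
      (Eventually.of_forall fun y => hC x y)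
  have hinner : ∀ (u : Lp ℝ 2 μ) x, ⟪u, (hGx x).toLp _⟫_ℝ = ∫ y, G x y * u y ∂μ := fun u x => by
    rw [L2.inner_def]
    refine integral_congr_ae ?_
    filter_upwards [(hGx x).coeFn_toLp] with y hy
    rw [hy]
    simp
  have hpt : ∀ x, Tendsto (fun n => ∫ y, G x y * v n y ∂μ) atTop
      (𝓝 (∫ y, G x y * w y ∂μ)) := fun x => by
    simpa only [hinner] using hlim ((hGx x).toLp _)
  set D := |C| * ((∫ _, (1 : ℝ) ∂μ) ^ (1 / 2 : ℝ) * 1) with hD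
  have hbd : ∀ n x, |∫ y, G x y * v n y ∂μ| ≤ D := fun n x => by
    calc _ ≤ C * ∫ y, |v n y| ∂μ := abs_integral_kernel_le hC (hint _) x
      _ ≤ |C| * ∫ y, |v n y| ∂μ := by gcongr; exact le_abs_self C
      _ ≤ |C| * ((∫ _, (1 : ℝ) ∂μ) ^ (1 / 2 : ℝ) * ‖v n‖) := by
          gcongr; exact integral_abs_le_norm _
      _ ≤ _ := by rw [hD]; gcongr; exact hv n
  have hbdw : ∀ x, |∫ y, G x y * w y ∂μ| ≤ D := fun x =>
    le_of_tendsto (hpt x).abs (Eventually.of_forall fun n => hbd n x)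
  rw [tendsto_iff_norm_sub_tendsto_zero]
  have hnorm : ∀ n, ‖T (v n) - T w‖ ^ 2 =
      ∫ x, ((∫ y, G x y * v n y ∂μ) - ∫ y, G x y * w y ∂μ) ^ 2 ∂μ := fun n => by
    rw [← real_inner_self_eq_norm_sq, L2.inner_def]
    refine integral_congr_ae ?_
    filter_upwards [hT (v n), hT w, Lp.coeFn_sub (T (v n)) (T w)] with x h1 h2 h3
    rw [h3, Pi.sub_apply, h1, h2]
    simp [sq]
  have hsq : Tendsto (fun n => ‖T (v n) - T w‖ ^ 2) atTop (𝓝 0) := by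
    simp only [hnorm]
    rw [show (0 : ℝ) = ∫ _ : X, (0 : ℝ) ∂μ by simp]
    refine tendsto_integral_of_dominated_convergence (fun _ => (2 * D) ^ 2) (fun n => ?_)
      (integrable_const _) (fun n => Eventually.of_forall fun x => ?_)
      (Eventually.of_forall fun x => ?_)
    · exact ((memLp_integral_kernel hG hC (hint _)).aestronglyMeasurable.sub
        (memLp_integral_kernel hG hC (hint _)).aestronglyMeasurable).pow 2
    · rw [Real.norm_eq_abs, abs_pow]
      gcongr
      refine (abs_sub _ _).trans ?_
      linarith [hbd n x, hbdw x]
    · simpa using ((hpt x).sub_const (∫ y, G x y * w y ∂μ)).pow 2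
  simpa using hsq.sqrt

theorem exists_kernel_eigenfunction [MeasurableSpace.CountablyGenerated X]
    (hG : Measurable (Function.uncurry G))
    (hC : ∀ x y, |G x y| ≤ C) (hsymm : ∀ x y, G x y = G y x)
    {v₀ : X → ℝ} (hv₀ : MemLp v₀ 2 μ) (hpos : 0 < ∫ x, (∫ y, G x y * v₀ y ∂μ) * v₀ x ∂μ) :
    ∃ M > 0, (∃ w : X → ℝ, Integrable w μ ∧ ¬ w =ᵐ[μ] 0 ∧
      ∀ᵐ x ∂μ, ∫ y, G x y * w y ∂μ = M * w x) ∧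
      ∀ v : X → ℝ, MemLp v 2 μ →
        ∫ x, (∫ y, G x y * v y ∂μ) * v x ∂μ ≤ M * ∫ x, v x ^ 2 ∂μ := by
  have : Fact ((2 : ENNReal) ≠ ⊤) := ⟨by norm_num⟩
  obtain ⟨T, hT⟩ := exists_kernel_operator (μ := μ) hG hC
  have hform : ∀ (v : X → ℝ) (hv : MemLp v 2 μ),
      ⟪T (hv.toLp v), hv.toLp v⟫_ℝ = ∫ x, (∫ y, G x y * v y ∂μ) * v x ∂μ := fun v hv => by
    rw [L2.inner_def]
    refine integral_congr_ae ?_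
    filter_upwards [hT (hv.toLp v), hv.coeFn_toLp] with x h1 h2
    have : ∫ y, G x y * hv.toLp v y ∂μ = ∫ y, G x y * v y ∂μ :=
      integral_congr_ae (hv.coeFn_toLp.mono fun y hy => by simp only [hy])
    rw [h1, h2, this]
    simp [mul_comm]
  obtain ⟨M, hM, ⟨w, hw0, hw⟩, hle⟩ := exists_eigenvector_of_weak_continuous T
    (isSelfAdjoint_kernel_operator hG hC hsymm hT) (kernel_operator_tendsto hG hC hT)
    (hv₀.toLp v₀) (by rwa [hform])
  refine ⟨M, hM, ⟨w, (Lp.memLp w).integrable (by norm_num),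
    fun h => hw0 ((Lp.eq_zero_iff_ae_eq_zero).mpr h), ?_⟩, fun v hv => ?_⟩
  · filter_upwards [hT w, Lp.coeFn_smul M w] with x h1 h2
    rw [← h1, hw, h2, Pi.smul_apply, smul_eq_mul]
  · have := hle (hv.toLp v)
    rw [hform, ← real_inner_self_eq_norm_sq, L2.inner_def] at this
    refine this.trans_eq (congrArg _ (integral_congr_ae ?_))
    filter_upwards [hv.coeFn_toLp] with x hx
    rw [hx]
    simp [sq]

end Kernel

theorem tendsto_atBot_of_deriv_ge {t t' : ℝ → ℝ} {a b c : ℝ} (hab : a < b) (hc : 0 < c)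
    (ht : ∀ x ∈ Ioo a b, HasDerivAt t (t' x) x) (hle : ∀ x ∈ Ioo a b, c / (x - a) ≤ t' x) :
    Tendsto t (𝓝[>] a) atBot := by
  set m := (a + b) / 2 with hm
  have ham : a < m := by rw [hm]; linarith
  have hmb : m < b := by rw [hm]; linarith
  have hderiv : ∀ x ∈ Ioo a b,
      HasDerivAt (fun x => t x - c * Real.log (x - a)) (t' x - c / (x - a)) x := fun x hx => by
    have h := ((hasDerivAt_id x).sub_const a).log (sub_ne_zero.mpr hx.1.ne')
    refine ((ht x hx).sub (h.const_mul c)).congr_deriv ?_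
    simp [div_eq_mul_inv]
  have hmono : MonotoneOn (fun x => t x - c * Real.log (x - a)) (Ioo a b) := by
    refine monotoneOn_of_deriv_nonneg (convex_Ioo a b)
      (fun x hx => (hderiv x hx).continuousAt.continuousWithinAt) ?_ ?_ <;>
    rw [interior_Ioo]
    · exact fun x hx => (hderiv x hx).differentiableAt.differentiableWithinAt
    · intro x hx
      rw [(hderiv x hx).deriv]
      linarith [hle x hx]
  have hlog : Tendsto (fun x => Real.log (x - a)) (𝓝[>] a) atBot := by
    refine Real.tendsto_log_nhdsGT_zero.comp (tendsto_nhdsWithin_iff.mpr ⟨?_, ?_⟩)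
    · have : Tendsto (fun x => x - a) (𝓝 a) (𝓝 (a - a)) := tendsto_id.sub_const a
      rw [sub_self] at this
      exact this.mono_left nhdsWithin_le_nhds
    · filter_upwards [self_mem_nhdsWithin] with x hx
      exact sub_pos.mpr (mem_Ioi.mp hx)
  refine tendsto_atBot_mono' _ ?_
    (tendsto_atBot_add_const_left _ (t m - c * Real.log (m - a)) (hlog.const_mul_atBot hc))
  filter_upwards [Ioo_mem_nhdsGT ham] with x hx
  have := hmono ⟨hx.1, hx.2.trans hmb⟩ ⟨ham, hmb⟩ hx.2.le
  simp only at this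
  linarith

theorem tendsto_atBot_of_deriv_eq_inv {f t : ℝ → ℝ} {a b d : ℝ} (hab : a < b)
    (hf : HasDerivAt f d a) (ha : f a = 0) (hd : 0 < d) (hpos : ∀ x ∈ Ioo a b, 0 < f x)
    (ht : ∀ x ∈ Ioo a b, HasDerivAt t (1 / f x) x) : Tendsto t (𝓝[>] a) atBot := by
  have hev : ∀ᶠ x in 𝓝[>] a, f x ≤ 2 * d * (x - a) := by
    have h := hf.hasDerivWithinAt (s := Ioi a)
    rw [hasDerivWithinAt_iff_tendsto_slope' (by simp)] at h
    filter_upwards [h.eventually_lt_const (by linarith : d < 2 * d), self_mem_nhdsWithin]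
      with x hx hxa
    rw [slope_def_field, ha, sub_zero, div_lt_iff₀ (sub_pos.mpr hxa)] at hx
    exact hx.le
  obtain ⟨e, he, hsub⟩ := mem_nhdsGT_iff_exists_Ioo_subset.mp hev
  refine tendsto_atBot_of_deriv_ge (lt_min hab he) (show 0 < 1 / (2 * d) by positivity)
    (fun x hx => ht x ⟨hx.1, hx.2.trans_le (min_le_left _ _)⟩) fun x hx => ?_
  have h1 : f x ≤ 2 * d * (x - a) := hsub ⟨hx.1, hx.2.trans_le (min_le_right _ _)⟩
  have h2 := hpos x ⟨hx.1, hx.2.trans_le (min_le_left _ _)⟩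
  rw [div_div]
  exact one_div_le_one_div_of_le h2 h1

theorem tendsto_atTop_of_deriv_eq_inv {f t : ℝ → ℝ} {a b d : ℝ} (hab : a < b)
    (hf : HasDerivAt f d b) (hb : f b = 0) (hd : d < 0) (hpos : ∀ x ∈ Ioo a b, 0 < f x)
    (ht : ∀ x ∈ Ioo a b, HasDerivAt t (1 / f x) x) : Tendsto t (𝓝[<] b) atTop := by
  have hmem : ∀ x ∈ Ioo (-b) (-a), -x ∈ Ioo a b := fun x hx =>
    ⟨by linarith [hx.2], by linarith [hx.1]⟩
  have key : Tendsto (fun x => -t (-x)) (𝓝[>] (-b)) atBot := by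
    refine tendsto_atBot_of_deriv_eq_inv (f := fun x => f (-x)) (d := -d) (neg_lt_neg hab) ?_
      (by simpa using hb) (by linarith) (fun x hx => hpos _ (hmem x hx)) fun x hx => ?_
    · have := HasDerivAt.comp (-b) (h := fun x => -x) (by simpa using hf) (hasDerivAt_neg (-b))
      simpa [Function.comp_def] using this
    · have := (HasDerivAt.comp x (ht _ (hmem x hx)) (hasDerivAt_neg x)).fun_neg
      simpa [Function.comp_def] using this
  have h2 := (tendsto_neg_atBot_atTop.comp key).comp (tendsto_neg_nhdsLT (a := b))
  simpa [Function.comp_def] using h2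

theorem exists_primitive_inv {f : ℝ → ℝ} (hcont : ContinuousOn f (Ioo (-1) 1))
    (hpos : ∀ x ∈ Ioo (-1 : ℝ) 1, 0 < f x) :
    ∃ t : ℝ → ℝ, Measurable t ∧ ∀ x ∈ Ioo (-1 : ℝ) 1, HasDerivAt t (1 / f x) x := by
  have hinv : ContinuousOn (fun x => 1 / f x) (Ioo (-1) 1) :=
    continuousOn_const.div hcont fun x hx => (hpos x hx).ne'
  have hderiv : ∀ x ∈ Ioo (-1 : ℝ) 1,
      HasDerivAt (fun x => ∫ s in (0 : ℝ)..x, 1 / f s) (1 / f x) x := by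
    intro x hx
    have hsub : uIcc 0 x ⊆ Ioo (-1) 1 :=
      (convex_Ioo (-1 : ℝ) 1).ordConnected.uIcc_subset (by norm_num) hx
    exact integral_hasDerivAt_right (hinv.mono hsub).intervalIntegrable
      (hinv.stronglyMeasurableAtFilter isOpen_Ioo x hx) (hinv.continuousAt (isOpen_Ioo.mem_nhds hx))
  refine ⟨(Ioo (-1) 1).indicator fun x => ∫ s in (0 : ℝ)..x, 1 / f s, ?_, fun x hx => ?_⟩
  · classical
    rw [← piecewise_eq_indicator]
    exact ContinuousOn.measurable_piecewise
      (fun x hx => (hderiv x hx).continuousAt.continuousWithinAt) continuousOn_const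
      measurableSet_Ioo
  · refine (hderiv x hx).congr_of_eventuallyEq ?_
    filter_upwards [isOpen_Ioo.mem_nhds hx] with y hy using indicator_of_mem hy _

/-- The Green kernel of `-d²/dt² + κ²` on the line, in the coordinate `t`. -/
noncomputable def greenKernel (κ : ℝ) (t : ℝ → ℝ) (x y : ℝ) : ℝ :=
  Real.exp (-κ * |t x - t y|) / (2 * κ)

section Green

variable {κ : ℝ} {t : ℝ → ℝ}

theorem greenKernel_measurable (ht : Measurable t) :
    Measurable (Function.uncurry (greenKernel κ t)) := by
  unfold greenKernel Function.uncurry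
  fun_prop

theorem greenKernel_symm (x y : ℝ) : greenKernel κ t x y = greenKernel κ t y x := by
  rw [greenKernel, greenKernel, abs_sub_comm]

theorem abs_greenKernel_le (hκ : 0 < κ) (x y : ℝ) : |greenKernel κ t x y| ≤ 1 / (2 * κ) := by
  rw [greenKernel, abs_of_pos (by positivity)]
  gcongr
  rw [Real.exp_le_one_iff]
  nlinarith [abs_nonneg (t x - t y)]

theorem greenKernel_of_le {x y : ℝ} (h : t y ≤ t x) :
    greenKernel κ t x y = Real.exp (-κ * t x) * Real.exp (κ * t y) / (2 * κ) := by
  rw [greenKernel, abs_of_nonneg (sub_nonneg.mpr h), ← Real.exp_add]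
  ring_nf

theorem greenKernel_of_ge {x y : ℝ} (h : t x ≤ t y) :
    greenKernel κ t x y = Real.exp (κ * t x) * Real.exp (-κ * t y) / (2 * κ) := by
  rw [greenKernel, abs_of_nonpos (sub_nonpos.mpr h), ← Real.exp_add]
  ring_nf

variable {μ : Measure ℝ} {v : ℝ → ℝ}

theorem tendsto_integral_greenKernel_zero (hκ : 0 < κ) (ht : Measurable t) (hv : Integrable v μ)
    {l : Filter ℝ} [l.IsCountablyGenerated] (hl : Tendsto (fun x => |t x|) l atTop) :
    Tendsto (fun x => ∫ y, greenKernel κ t x y * v y ∂μ) l (𝓝 0) := by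
  rw [show (0 : ℝ) = ∫ _ : ℝ, (0 : ℝ) ∂μ by simp]
  refine tendsto_integral_filter_of_dominated_convergence (fun y => 1 / (2 * κ) * |v y|)
    (Eventually.of_forall fun x => (integrable_kernel_mul (greenKernel_measurable ht)
      (abs_greenKernel_le hκ) hv x).aestronglyMeasurable)
    (Eventually.of_forall fun x => Eventually.of_forall fun y => ?_) (hv.abs.const_mul _)
    (Eventually.of_forall fun y => ?_)
  · rw [Real.norm_eq_abs, abs_mul]
    exact mul_le_mul_of_nonneg_right (abs_greenKernel_le hκ x y) (abs_nonneg _)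
  · have h1 : Tendsto (fun x => |t x - t y|) l atTop := by
      refine tendsto_atTop_mono (fun x => abs_sub_abs_le_abs_sub (t x) (t y)) ?_
      exact tendsto_atTop_add_const_right _ (-|t y|) hl
    have h2 := Real.tendsto_exp_atBot.comp (h1.const_mul_atTop_of_neg (neg_lt_zero.mpr hκ))
    simpa [greenKernel] using (h2.div_const (2 * κ)).mul_const (v y)

theorem continuousAt_integral_greenKernel (hκ : 0 < κ) (ht : Measurable t) (hv : Integrable v μ)
    {x : ℝ} (hx : ContinuousAt t x) :
    ContinuousAt (fun x => ∫ y, greenKernel κ t x y * v y ∂μ) x := by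
  refine continuousAt_of_dominated (bound := fun y => 1 / (2 * κ) * |v y|)
    (Eventually.of_forall fun x => (integrable_kernel_mul (greenKernel_measurable ht)
      (abs_greenKernel_le hκ) hv x).aestronglyMeasurable)
    (Eventually.of_forall fun x => Eventually.of_forall fun y => ?_) (hv.abs.const_mul _)
    (Eventually.of_forall fun y => ?_)
  · rw [Real.norm_eq_abs, abs_mul]
    exact mul_le_mul_of_nonneg_right (abs_greenKernel_le hκ x y) (abs_nonneg _)
  · unfold greenKernel
    fun_prop

end Green

section Interval

variable {κ a b : ℝ} {t v : ℝ → ℝ}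

/-- The part of the Green potential of `v` generated on the left of `x`. -/
noncomputable def leftPart (κ a : ℝ) (t v : ℝ → ℝ) (x : ℝ) : ℝ :=
  Real.exp (-κ * t x) * ∫ y in a..x, Real.exp (κ * t y) * v y

/-- The part of the Green potential of `v` generated on the right of `x`. -/
noncomputable def rightPart (κ b : ℝ) (t v : ℝ → ℝ) (x : ℝ) : ℝ :=
  Real.exp (κ * t x) * ∫ y in x..b, Real.exp (-κ * t y) * v y

theorem intervalIntegrable_exp_mul_left (hκ : 0 < κ) (ht : Measurable t)
    (hmono : MonotoneOn t (Ioo a b)) (hv : IntegrableOn v (Ioc a b)) {x : ℝ} (hx : x ∈ Ioo a b) :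
    IntervalIntegrable (fun y => Real.exp (κ * t y) * v y) volume a x := by
  rw [intervalIntegrable_iff_integrableOn_Ioc_of_le hx.1.le]
  refine Integrable.bdd_mul (c := Real.exp (κ * t x))
    (hv.mono_set (Ioc_subset_Ioc_right hx.2.le)) (by fun_prop) ?_
  filter_upwards [ae_restrict_mem measurableSet_Ioc] with y hy
  rw [Real.norm_eq_abs, Real.abs_exp]
  gcongr
  exact hmono ⟨hy.1, hy.2.trans_lt hx.2⟩ hx hy.2

theorem intervalIntegrable_exp_mul_right (hκ : 0 < κ) (ht : Measurable t)
    (hmono : MonotoneOn t (Ioo a b)) (hv : IntegrableOn v (Ioc a b)) {x : ℝ} (hx : x ∈ Ioo a b) :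
    IntervalIntegrable (fun y => Real.exp (-κ * t y) * v y) volume x b := by
  rw [intervalIntegrable_iff_integrableOn_Ioo_of_le hx.2.le]
  refine Integrable.bdd_mul (c := Real.exp (-κ * t x))
    (hv.mono_set (Ioo_subset_Ioc_self.trans (Ioc_subset_Ioc_left hx.1.le))) (by fun_prop) ?_
  filter_upwards [ae_restrict_mem measurableSet_Ioo] with y hy
  rw [Real.norm_eq_abs, Real.abs_exp, Real.exp_le_exp]
  have := hmono hx ⟨hx.1.trans hy.1, hy.2⟩ hy.1.le
  nlinarith

theorem integral_greenKernel_eq (hκ : 0 < κ) (ht : Measurable t)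
    (hmono : MonotoneOn t (Ioo a b)) (hv : IntegrableOn v (Ioc a b)) {x : ℝ} (hx : x ∈ Ioo a b) :
    ∫ y in Ioc a b, greenKernel κ t x y * v y =
      (rightPart κ b t v x + leftPart κ a t v x) / (2 * κ) := by
  have hint : IntegrableOn (fun y => greenKernel κ t x y * v y) (Ioc a b) :=
    integrable_kernel_mul (greenKernel_measurable ht) (abs_greenKernel_le hκ) hv x
  have hab : a ≤ b := (hx.1.trans hx.2).le
  rw [← integral_of_le hab, ← integral_add_adjacent_intervals (b := x)
    ((intervalIntegrable_iff_integrableOn_Ioc_of_le hx.1.le).mpr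
      (hint.mono_set (Ioc_subset_Ioc_right hx.2.le)))
    ((intervalIntegrable_iff_integrableOn_Ioc_of_le hx.2.le).mpr
      (hint.mono_set (Ioc_subset_Ioc_left hx.1.le))), add_comm, add_div, rightPart, leftPart]
  congr 1
  · rw [mul_div_right_comm, ← intervalIntegral.integral_const_mul, integral_of_le hx.2.le,
      integral_of_le hx.2.le, integral_Ioc_eq_integral_Ioo, integral_Ioc_eq_integral_Ioo]
    refine setIntegral_congr_fun measurableSet_Ioo fun y hy => ?_
    simp only [greenKernel_of_ge (hmono hx ⟨hx.1.trans hy.1, hy.2⟩ hy.1.le)]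
    ring
  · rw [mul_div_right_comm, ← intervalIntegral.integral_const_mul, integral_of_le hx.1.le,
      integral_of_le hx.1.le]
    refine setIntegral_congr_fun measurableSet_Ioc fun y hy => ?_
    simp only [greenKernel_of_le (hmono ⟨hy.1, hy.2.trans_lt hx.2⟩ hx hy.2)]
    ring

theorem abs_leftPart_le {a x : ℝ} (hab : a ≤ x) (κ : ℝ) (t v : ℝ → ℝ) :
    |leftPart κ a t v x| ≤ leftPart κ a t (fun y => |v y|) x := by
  rw [leftPart, leftPart, abs_mul, Real.abs_exp]
  gcongr
  refine (abs_integral_le_integral_abs hab).trans_eq ?_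
  simp only [abs_mul, Real.abs_exp]

theorem abs_rightPart_le {b x : ℝ} (hab : x ≤ b) (κ : ℝ) (t v : ℝ → ℝ) :
    |rightPart κ b t v x| ≤ rightPart κ b t (fun y => |v y|) x := by
  rw [rightPart, rightPart, abs_mul, Real.abs_exp]
  gcongr
  refine (abs_integral_le_integral_abs hab).trans_eq ?_
  simp only [abs_mul, Real.abs_exp]

/-- The flux `f w'` of the Green potential `w` of `v`. -/
noncomputable def greenFlux (κ a b : ℝ) (t v : ℝ → ℝ) (x : ℝ) : ℝ :=
  (rightPart κ b t v x - leftPart κ a t v x) / 2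

theorem abs_greenFlux_le (hκ : 0 < κ) (ht : Measurable t)
    (hmono : MonotoneOn t (Ioo a b)) (hv : IntegrableOn v (Ioc a b)) {x : ℝ} (hx : x ∈ Ioo a b) :
    |greenFlux κ a b t v x| ≤ 1 / 2 * ∫ y in Ioc a b, |v y| := by
  have h1 := abs_leftPart_le hx.1.le κ t v
  have h2 := abs_rightPart_le hx.2.le κ t v
  have h3 := integral_greenKernel_eq hκ ht hmono hv.abs hx
  have h4 := abs_integral_kernel_le (abs_greenKernel_le (t := t) hκ) hv.abs x
  simp only [abs_abs] at h4
  have h5 := (le_abs_self _).trans h4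
  change ∫ y in Ioc a b, greenKernel κ t x y * |v y| = _ at h3
  rw [h3, one_div, inv_mul_eq_div, div_le_div_iff_of_pos_right (by positivity)] at h5
  rw [greenFlux, abs_div, abs_two]
  have := abs_sub (rightPart κ b t v x) (leftPart κ a t v x)
  linarith

variable {t' : ℝ → ℝ}

theorem hasDerivAt_leftPart (hκ : 0 < κ) (ht : Measurable t)
    (hmono : MonotoneOn t (Ioo a b)) (hderiv : ∀ x ∈ Ioo a b, HasDerivAt t (t' x) x)
    (hv : IntegrableOn v (Ioc a b)) (hvc : ContinuousOn v (Ioo a b)) {x : ℝ} (hx : x ∈ Ioo a b) :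
    HasDerivAt (leftPart κ a t v) (v x - κ * t' x * leftPart κ a t v x) x := by
  have htc : ContinuousOn t (Ioo a b) := fun y hy => (hderiv y hy).continuousAt.continuousWithinAt
  have hc : ContinuousOn (fun y => Real.exp (κ * t y) * v y) (Ioo a b) := by fun_prop
  have h1 := integral_hasDerivAt_right (intervalIntegrable_exp_mul_left hκ ht hmono hv hx)
    (hc.stronglyMeasurableAtFilter isOpen_Ioo x hx) (hc.continuousAt (isOpen_Ioo.mem_nhds hx))
  refine (((hderiv x hx).const_mul (-κ)).exp.mul h1).congr_deriv ?_
  have : Real.exp (-κ * t x) * (Real.exp (κ * t x) * v x) = v x := by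
    rw [← mul_assoc, ← Real.exp_add]
    simp
  rw [this, leftPart]
  ring

theorem hasDerivAt_rightPart (hκ : 0 < κ) (ht : Measurable t)
    (hmono : MonotoneOn t (Ioo a b)) (hderiv : ∀ x ∈ Ioo a b, HasDerivAt t (t' x) x)
    (hv : IntegrableOn v (Ioc a b)) (hvc : ContinuousOn v (Ioo a b)) {x : ℝ} (hx : x ∈ Ioo a b) :
    HasDerivAt (rightPart κ b t v) (κ * t' x * rightPart κ b t v x - v x) x := by
  have htc : ContinuousOn t (Ioo a b) := fun y hy => (hderiv y hy).continuousAt.continuousWithinAt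
  have hc : ContinuousOn (fun y => Real.exp (-κ * t y) * v y) (Ioo a b) := by fun_prop
  have h1 := integral_hasDerivAt_left (intervalIntegrable_exp_mul_right hκ ht hmono hv hx)
    (hc.stronglyMeasurableAtFilter isOpen_Ioo x hx) (hc.continuousAt (isOpen_Ioo.mem_nhds hx))
  refine (((hderiv x hx).const_mul κ).exp.mul h1).congr_deriv ?_
  have : Real.exp (κ * t x) * (Real.exp (-κ * t x) * v x) = v x := by
    rw [← mul_assoc, ← Real.exp_add]
    simp
  rw [mul_neg, this, rightPart]
  ring

theorem hasDerivAt_integral_greenKernel (hκ : 0 < κ) (ht : Measurable t)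
    (hmono : MonotoneOn t (Ioo a b)) (hderiv : ∀ x ∈ Ioo a b, HasDerivAt t (t' x) x)
    (hv : IntegrableOn v (Ioc a b)) (hvc : ContinuousOn v (Ioo a b)) {x : ℝ} (hx : x ∈ Ioo a b) :
    HasDerivAt (fun x => ∫ y in Ioc a b, greenKernel κ t x y * v y)
      (t' x * greenFlux κ a b t v x) x := by
  have h := ((hasDerivAt_rightPart hκ ht hmono hderiv hv hvc hx).add
    (hasDerivAt_leftPart hκ ht hmono hderiv hv hvc hx)).div_const (2 * κ)
  refine (h.congr_deriv ?_).congr_of_eventuallyEq ?_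
  · rw [greenFlux]
    field_simp
    ring
  · filter_upwards [isOpen_Ioo.mem_nhds hx] with y hy
    exact integral_greenKernel_eq hκ ht hmono hv hy

theorem hasDerivAt_greenFlux (hκ : 0 < κ) (ht : Measurable t)
    (hmono : MonotoneOn t (Ioo a b)) (hderiv : ∀ x ∈ Ioo a b, HasDerivAt t (t' x) x)
    (hv : IntegrableOn v (Ioc a b)) (hvc : ContinuousOn v (Ioo a b)) {x : ℝ} (hx : x ∈ Ioo a b) :
    HasDerivAt (greenFlux κ a b t v)
      (κ ^ 2 * t' x * (∫ y in Ioc a b, greenKernel κ t x y * v y) - v x) x := by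
  have h := ((hasDerivAt_rightPart hκ ht hmono hderiv hv hvc hx).sub
    (hasDerivAt_leftPart hκ ht hmono hderiv hv hvc hx)).div_const 2
  refine h.congr_deriv ?_
  rw [integral_greenKernel_eq hκ ht hmono hv hx]
  field_simp
  ring

end Interval

theorem contDiffOn_of_linear_system {s : Set ℝ} (hs : IsOpen s) {p r w q : ℝ → ℝ}
    (hp : ContDiffOn ℝ (⊤ : ℕ∞) p s) (hr : ContDiffOn ℝ (⊤ : ℕ∞) r s)
    (hw : ∀ x ∈ s, HasDerivAt w (p x * q x) x) (hq : ∀ x ∈ s, HasDerivAt q (r x * w x) x) :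
    ContDiffOn ℝ (⊤ : ℕ∞) w s := by
  have key : ∀ n : ℕ, ContDiffOn ℝ n w s ∧ ContDiffOn ℝ n q s := by
    intro n
    induction n with
    | zero =>
      simp only [Nat.cast_zero, contDiffOn_zero]
      exact ⟨fun x hx => (hw x hx).continuousAt.continuousWithinAt,
        fun x hx => (hq x hx).continuousAt.continuousWithinAt⟩
    | succ n ih =>
      push_cast
      have hle : (n : WithTop ℕ∞) ≤ ((⊤ : ℕ∞) : WithTop ℕ∞) := by
        exact_mod_cast (le_top : (n : ℕ∞) ≤ ⊤)
      rw [contDiffOn_succ_iff_deriv_of_isOpen hs, contDiffOn_succ_iff_deriv_of_isOpen hs]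
      refine ⟨⟨fun x hx => (hw x hx).differentiableAt.differentiableWithinAt, by simp, ?_⟩,
        fun x hx => (hq x hx).differentiableAt.differentiableWithinAt, by simp, ?_⟩
      · exact ((hp.of_le hle).mul ih.2).congr fun x hx => (hw x hx).deriv
      · exact ((hr.of_le hle).mul ih.1).congr fun x hx => (hq x hx).deriv
  exact contDiffOn_infty.mpr fun n => (key n).1

theorem continuousOn_indicator_Ioo {a b : ℝ} {w : ℝ → ℝ}
    (hw : ∀ x ∈ Ioo a b, ContinuousAt w x) (ha : Tendsto w (𝓝[>] a) (𝓝 0))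
    (hb : Tendsto w (𝓝[<] b) (𝓝 0)) : ContinuousOn ((Ioo a b).indicator w) (Icc a b) := by
  intro x hx
  have hab : a ≤ b := hx.1.trans hx.2
  rcases hx.1.eq_or_lt with rfl | hax
  · rcases hab.eq_or_lt with rfl | hab
    · simp
    refine (continuousWithinAt_Ioi_iff_Ici.mp ?_).mono Icc_subset_Ici_self
    rw [ContinuousWithinAt, indicator_of_notMem (by simp)]
    refine ha.congr' ?_
    filter_upwards [Ioo_mem_nhdsGT hab] with y hy using (indicator_of_mem hy _).symm
  rcases hx.2.eq_or_lt with rfl | hxb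
  · refine (continuousWithinAt_Iio_iff_Iic.mp ?_).mono Icc_subset_Iic_self
    rw [ContinuousWithinAt, indicator_of_notMem (by simp)]
    refine hb.congr' ?_
    filter_upwards [Ioo_mem_nhdsLT hax] with y hy using (indicator_of_mem hy _).symm
  · refine ((hw x ⟨hax, hxb⟩).congr ?_).continuousWithinAt
    filter_upwards [isOpen_Ioo.mem_nhds ⟨hax, hxb⟩] with y hy using (indicator_of_mem hy _).symm

theorem continuousOn_mul_of_bounded {a b C : ℝ} {h q : ℝ → ℝ} (hh : ContinuousOn h (Icc a b))
    (ha : h a = 0) (hb : h b = 0) (hq : ContinuousOn q (Ioo a b))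
    (hC : ∀ x ∈ Ioo a b, |q x| ≤ C) : ContinuousOn (fun x => h x * q x) (Icc a b) := by
  have hle : ∀ y ∈ Icc a b, ‖h y * q y‖ ≤ |h y| * C := fun y hy => by
    rw [Real.norm_eq_abs, abs_mul]
    rcases hy.1.eq_or_lt with rfl | hay
    · simp [ha]
    rcases hy.2.eq_or_lt with rfl | hyb
    · simp [hb]
    · exact mul_le_mul_of_nonneg_left (hC y ⟨hay, hyb⟩) (abs_nonneg _)
  have hzero : ∀ x ∈ Icc a b, h x = 0 →
      ContinuousWithinAt (fun x => h x * q x) (Icc a b) x := fun x hx h0 => by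
    rw [ContinuousWithinAt, h0, zero_mul]
    refine squeeze_zero_norm' (eventually_nhdsWithin_of_forall hle) ?_
    have := (((hh x hx).abs).mul_const C).tendsto
    simpa only [h0, abs_zero, zero_mul] using this
  intro x hx
  rcases hx.1.eq_or_lt with rfl | hax
  · exact hzero a hx ha
  rcases hx.2.eq_or_lt with rfl | hxb
  · exact hzero x hx hb
  · exact (hh x hx).mul
      (hq.continuousAt (isOpen_Ioo.mem_nhds ⟨hax, hxb⟩)).continuousWithinAt

section Profile

variable {f t : ℝ → ℝ}

/-- A coordinate on `(-1, 1)` with differential `dx / f`, reaching infinity at both ends. -/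
structure IsCoordinate (f t : ℝ → ℝ) : Prop where
  measurable : Measurable t
  hasDerivAt : ∀ x ∈ Ioo (-1 : ℝ) 1, HasDerivAt t (1 / f x) x
  mono : MonotoneOn t (Ioo (-1) 1)
  tendsto_left : Tendsto (fun x => |t x|) (𝓝[>] (-1)) atTop
  tendsto_right : Tendsto (fun x => |t x|) (𝓝[<] 1) atTop

theorem IsProfile.exists_isCoordinate (hf : IsProfile f) : ∃ t, IsCoordinate f t := by
  obtain ⟨t, ht, hderiv⟩ :=
    exists_primitive_inv (hf.contOn.mono Ioo_subset_Icc_self) hf.pos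
  refine ⟨t, ht, hderiv, ?_, ?_, ?_⟩
  · refine monotoneOn_of_deriv_nonneg (convex_Ioo _ _)
      (fun x hx => (hderiv x hx).continuousAt.continuousWithinAt) ?_ ?_ <;>
    rw [interior_Ioo]
    · exact fun x hx => (hderiv x hx).differentiableAt.differentiableWithinAt
    · intro x hx
      rw [(hderiv x hx).deriv]
      exact one_div_nonneg.mpr (hf.pos x hx).le
  · exact tendsto_abs_atBot_atTop.comp (tendsto_atBot_of_deriv_eq_inv (by norm_num)
      hf.deriv_neg_one hf.zero_neg_one (by norm_num) hf.pos hderiv)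
  · exact tendsto_abs_atTop_atTop.comp (tendsto_atTop_of_deriv_eq_inv (by norm_num)
      hf.deriv_one hf.zero_one (by norm_num) hf.pos hderiv)

variable {κ : ℝ} {v : ℝ → ℝ}

theorem IsCoordinate.continuousOn_potential (ht : IsCoordinate f t) (hκ : 0 < κ)
    (hv : IntegrableOn v (Ioc (-1) 1)) :
    ContinuousOn ((Ioo (-1) 1).indicator
      fun x => ∫ y in Ioc (-1) 1, greenKernel κ t x y * v y) (Icc (-1) 1) :=
  continuousOn_indicator_Ioo
    (fun x hx => continuousAt_integral_greenKernel hκ ht.measurable hv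
      (ht.hasDerivAt x hx).continuousAt)
    (tendsto_integral_greenKernel_zero hκ ht.measurable hv ht.tendsto_left)
    (tendsto_integral_greenKernel_zero hκ ht.measurable hv ht.tendsto_right)

theorem inSpec_of_kernel_eigenfunction (hf : IsProfile f) (ht : IsCoordinate f t) {k : ℕ}
    (hk : 1 ≤ k) {M : ℝ} (hM : 0 < M) {w : ℝ → ℝ} (hw : IntegrableOn w (Ioc (-1) 1))
    (hw0 : ¬ w =ᵐ[volume.restrict (Ioc (-1) 1)] 0)
    (heig : ∀ᵐ x ∂volume.restrict (Ioc (-1) 1),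
      ∫ y in Ioc (-1) 1, greenKernel k t x y * w y = M * w x) : InSpec f k M⁻¹ := by
  have hκ : (0 : ℝ) < k := by exact_mod_cast hk
  set W : ℝ → ℝ := fun x => ∫ y in Ioc (-1) 1, greenKernel k t x y * w y with hW
  set v : ℝ → ℝ := fun x => M⁻¹ * W x with hv
  have hvw : w =ᵐ[volume.restrict (Ioc (-1) 1)] v := by
    filter_upwards [heig] with x hx
    rw [hv, hW]
    simp only [hx]
    field_simp
  have hvint : IntegrableOn v (Ioc (-1) 1) := hw.congr hvw
  have hvc : ContinuousOn v (Ioo (-1) 1) := fun x hx =>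
    ((continuousAt_integral_greenKernel hκ ht.measurable hw
      (ht.hasDerivAt x hx).continuousAt).const_mul M⁻¹).continuousWithinAt
  have hWv : W = fun x => ∫ y in Ioc (-1) 1, greenKernel k t x y * v y := by
    funext x
    exact integral_congr_ae (hvw.mono fun y hy => by simp only [hy])
  set φ := (Ioo (-1) 1).indicator W with hφ
  have hφW : ∀ x ∈ Ioo (-1 : ℝ) 1, φ x = W x := fun x hx => indicator_of_mem hx _
  set q := greenFlux k (-1) 1 t v with hq
  have hder : ∀ x ∈ Ioo (-1 : ℝ) 1, HasDerivAt φ (1 / f x * q x) x := fun x hx => by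
    have := hasDerivAt_integral_greenKernel hκ ht.measurable ht.mono ht.hasDerivAt hvint hvc hx
    rw [← hWv] at this
    refine this.congr_of_eventuallyEq ?_
    filter_upwards [isOpen_Ioo.mem_nhds hx] with y hy using hφW y hy
  have hderq : ∀ x ∈ Ioo (-1 : ℝ) 1,
      HasDerivAt q (((k : ℝ) ^ 2 * (1 / f x) - M⁻¹) * φ x) x := fun x hx => by
    have := hasDerivAt_greenFlux hκ ht.measurable ht.mono ht.hasDerivAt hvint hvc hx
    refine this.congr_deriv ?_
    rw [← congrFun hWv x, hφW x hx, hv]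
    ring
  have hinv : ContDiffOn ℝ (⊤ : ℕ∞) (fun x => 1 / f x) (Ioo (-1) 1) :=
    contDiffOn_const.div hf.smoothOn fun x hx => (hf.pos x hx).ne'
  refine ⟨φ, ht.continuousOn_potential hκ hw, contDiffOn_of_linear_system isOpen_Ioo hinv
    ((contDiffOn_const.mul hinv).sub contDiffOn_const) hder hderq, ?_,
    fun _ => ⟨by simp [hφ], by simp [hφ]⟩, fun x hx => ?_⟩
  · by_contra! h
    refine hw0 (hvw.trans ?_)
    rw [Measure.restrict_congr_set Ioo_ae_eq_Ioc.symm]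
    filter_upwards [ae_restrict_mem measurableSet_Ioo] with x hx
    simp [hv, ← hφW x hx, h x hx]
  · have heq : (fun y => f y * deriv φ y) =ᶠ[𝓝 x] q := by
      filter_upwards [isOpen_Ioo.mem_nhds hx] with y hy
      rw [(hder y hy).deriv]
      field_simp [(hf.pos y hy).ne']
    rw [heq.deriv_eq, (hderq x hx).deriv]
    ring

theorem two_mul_integral_sq_sub_le (hf : IsProfile f) (ht : IsCoordinate f t) (hκ : 0 < κ)
    {u : ℝ → ℝ} (hu_cont : ContinuousOn u (Icc (-1) 1))
    (hu_diff : DifferentiableOn ℝ u (Ioo (-1) 1)) (hu_neg : u (-1) = 0) (hu_one : u 1 = 0)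
    (hint : IntervalIntegrable
      (fun x => f x * (deriv u x) ^ 2 + (κ ^ 2 / f x) * (u x) ^ 2) volume (-1) 1) (s : ℝ) :
    2 * s * (∫ x in Ioc (-1) 1, u x ^ 2) - s ^ 2 *
      (∫ x in Ioc (-1) 1, (∫ y in Ioc (-1) 1, greenKernel κ t x y * u y) * u x) ≤
      ∫ x in (-1 : ℝ)..1, (f x * (deriv u x) ^ 2 + (κ ^ 2 / f x) * (u x) ^ 2) := by
  have hle : (-1 : ℝ) ≤ 1 := by norm_num
  have hui : IntegrableOn u (Ioc (-1) 1) :=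
    (hu_cont.integrableOn_Icc).mono_set Ioc_subset_Icc_self
  have huc : ContinuousOn u (Ioo (-1) 1) := hu_cont.mono Ioo_subset_Icc_self
  set W : ℝ → ℝ := fun x => ∫ y in Ioc (-1) 1, greenKernel κ t x y * u y with hW
  set φ := (Ioo (-1) 1).indicator W with hφ
  have hφW : ∀ x ∈ Ioo (-1 : ℝ) 1, φ x = W x := fun x hx => indicator_of_mem hx _
  have hφc : ContinuousOn φ (Icc (-1) 1) := ht.continuousOn_potential hκ hui
  set q := greenFlux κ (-1) 1 t u with hq
  have hder : ∀ x ∈ Ioo (-1 : ℝ) 1, HasDerivAt φ (1 / f x * q x) x := fun x hx => by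
    refine (hasDerivAt_integral_greenKernel hκ ht.measurable ht.mono ht.hasDerivAt hui huc
      hx).congr_of_eventuallyEq ?_
    filter_upwards [isOpen_Ioo.mem_nhds hx] with y hy using hφW y hy
  have hderq : ∀ x ∈ Ioo (-1 : ℝ) 1,
      HasDerivAt q (κ ^ 2 * (1 / f x) * φ x - u x) x := fun x hx => by
    rw [hφW x hx]
    exact hasDerivAt_greenFlux hκ ht.measurable ht.mono ht.hasDerivAt hui huc hx
  have hderu : ∀ x ∈ Ioo (-1 : ℝ) 1, HasDerivAt u (deriv u x) x := fun x hx =>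
    (hu_diff.differentiableAt (isOpen_Ioo.mem_nhds hx)).hasDerivAt
  have hgc : ContinuousOn (fun x => (2 * s * u x - s ^ 2 * φ x) * q x) (Icc (-1) 1) :=
    continuousOn_mul_of_bounded (by fun_prop) (by simp [hφ, hu_neg]) (by simp [hφ, hu_one])
      (fun x hx => (hderq x hx).continuousAt.continuousWithinAt)
      fun x hx => abs_greenFlux_le hκ ht.measurable ht.mono hui hx
  have hu2 : IntervalIntegrable (fun x => 2 * s * u x ^ 2) volume (-1) 1 :=
    ContinuousOn.intervalIntegrable (by rw [uIcc_of_le hle]; fun_prop)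
  have hφu : IntervalIntegrable (fun x => s ^ 2 * (φ x * u x)) volume (-1) 1 :=
    ContinuousOn.intervalIntegrable (by rw [uIcc_of_le hle]; fun_prop)
  have hmain := sub_le_integral_of_hasDeriv_right_of_le hle hgc
    (fun x hx => ((((hderu x hx).const_mul (2 * s)).sub
      ((hder x hx).const_mul (s ^ 2))).mul (hderq x hx)).hasDerivWithinAt)
    ((intervalIntegrable_iff_integrableOn_Icc_of_le hle).mp ((hint.sub hu2).add hφu))
    fun x hx => by
      have hfx := hf.pos x hx
      have hsq : 0 ≤ f x * (deriv u x - s * (q x / f x)) ^ 2 +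
          κ ^ 2 / f x * (u x - s * φ x) ^ 2 := by positivity
      have hexp : f x * (deriv u x - s * (q x / f x)) ^ 2 =
          f x * deriv u x ^ 2 - 2 * s * deriv u x * q x + s ^ 2 * (1 / f x * q x) * q x := by
        field_simp
        ring
      rw [hexp] at hsq
      simp only [Pi.sub_apply]
      rw [← sub_nonneg]
      refine hsq.trans_eq ?_
      ring
  rw [intervalIntegral.integral_add (hint.sub hu2) hφu, intervalIntegral.integral_sub hint hu2,
    intervalIntegral.integral_const_mul, intervalIntegral.integral_const_mul] at hmain
  have hφeq : ∫ x in (-1 : ℝ)..1, φ x * u x = ∫ x in Ioc (-1) 1, W x * u x := by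
    rw [integral_of_le hle, integral_Ioc_eq_integral_Ioo, integral_Ioc_eq_integral_Ioo]
    exact setIntegral_congr_fun measurableSet_Ioo fun x hx => by simp only [hφW x hx]
  rw [hφeq, integral_of_le hle (f := fun x => u x ^ 2)] at hmain
  simp only [hu_neg, hu_one, hφ] at hmain
  simp at hmain
  linarith

end Profile

/-- The minimum (Rayleigh) principle for the first eigenvalue of `L_k`. -/
theorem rayleigh_quotient_bound (f : ℝ → ℝ) (hf : IsProfile f) (k : ℕ) (hk : 1 ≤ k)
    (lam : ℝ) (hlam : IsLeast (Spec f k) lam)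
    (u : ℝ → ℝ) (hu_cont : ContinuousOn u (Icc (-1) 1))
    (hu_smooth : ContDiffOn ℝ (⊤ : ℕ∞) u (Ioo (-1) 1))
    (hu_neg : u (-1) = 0) (hu_one : u 1 = 0)
    (hu_ne : ∃ x ∈ Ioo (-1:ℝ) 1, u x ≠ 0)
    (hint : IntervalIntegrable
      (fun x => f x * (deriv u x)^2 + ((k:ℝ)^2 / f x) * (u x)^2) volume (-1) 1) :
    lam ≤ (∫ x in (-1:ℝ)..1, (f x * (deriv u x)^2 + ((k:ℝ)^2 / f x) * (u x)^2)) /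
          (∫ x in (-1:ℝ)..1, (u x)^2) := by
  have hκ : (0 : ℝ) < k := by exact_mod_cast hk
  have hle : (-1 : ℝ) ≤ 1 := by norm_num
  obtain ⟨t, ht⟩ := hf.exists_isCoordinate
  have key := two_mul_integral_sq_sub_le hf ht hκ hu_cont (hu_smooth.differentiableOn (by simp))
    hu_neg hu_one hint
  have hmem : MemLp u 2 (volume.restrict (Ioc (-1) 1)) := by
    obtain ⟨C, hC⟩ := isCompact_Icc.exists_bound_of_continuousOn hu_cont
    refine MemLp.of_bound ((hu_cont.mono Ioc_subset_Icc_self).aestronglyMeasurable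
      measurableSet_Ioc) C ?_
    filter_upwards [ae_restrict_mem measurableSet_Ioc] with x hx
      using hC x (Ioc_subset_Icc_self hx)
  have hN : 0 < ∫ x in (-1 : ℝ)..1, u x ^ 2 := by
    obtain ⟨x, hx, hux⟩ := hu_ne
    exact intervalIntegral.integral_pos (by norm_num) (hu_cont.pow 2) (fun y _ => sq_nonneg _)
      ⟨x, Ioo_subset_Icc_self hx, by positivity⟩
  rw [le_div_iff₀ hN]
  rw [integral_of_le hle (f := fun x => u x ^ 2)] at hN ⊢
  set Q := ∫ x in (-1 : ℝ)..1, (f x * (deriv u x) ^ 2 + ((k : ℝ) ^ 2 / f x) * (u x) ^ 2) with hQ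
  set N := ∫ x in Ioc (-1) 1, u x ^ 2 with hNdef
  set P := ∫ x in Ioc (-1) 1, (∫ y in Ioc (-1) 1, greenKernel k t x y * u y) * u x with hPdef
  have hP : 0 < P := by
    by_contra! h
    have h1 := key ((|Q| + 1) / N)
    have h2 : 2 * ((|Q| + 1) / N) * N = 2 * (|Q| + 1) := by field_simp
    rw [h2] at h1
    nlinarith [le_abs_self Q, abs_nonneg Q, sq_nonneg ((|Q| + 1) / N)]
  obtain ⟨M, hM, ⟨w, hw, hw0, heig⟩, hbound⟩ := exists_kernel_eigenfunction
    (greenKernel_measurable ht.measurable) (abs_greenKernel_le hκ) greenKernel_symm hmem hP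
  have hspec : lam ≤ M⁻¹ := hlam.2 (inSpec_of_kernel_eigenfunction hf ht hk hM hw hw0 heig)
  have h1 : P ≤ M * N := hbound u hmem
  have h2 := key M⁻¹
  have h3 : M⁻¹ ^ 2 * P ≤ M⁻¹ * N := by
    calc M⁻¹ ^ 2 * P ≤ M⁻¹ ^ 2 * (M * N) := by gcongr
      _ = M⁻¹ * N := by field_simp
  nlinarith [mul_le_mul_of_nonneg_right hspec hN.le]
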